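/- Let (A^{•,•}, ∂, ∂̄) be a bounded double complex of finite-dimensional vector spaces over a field K. Then the ∂∂̄-lemma holds for (A^{•,•}, ∂, ∄̄) if and only if for every k ∈ ℤ one has Σ_{p+q=k} (dim_K H_BC^{p,q} + dim_K H_A^{p,q}) = 2·b_k. (Algebraic, double-complex form of Angella–Tomassini's quantitative characterization of the ∂∂̄-lemma.) -/

import Mathlib

open LinearMap Submodule Module DirectSum

namespace Paper

section DoubleComplex

variable (K : Type) [Field K]
variable (A : ℤ → ℤ → Type) [∀ p q, AddCommGroup (A p q)] [∀ p q, Module K (A p q)]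

/-- Transport along equalities of the indices. -/
def dcCast {p q p' q' : ℤ} (h1 : p = p') (h2 : q = q') : A p q ≃ₗ[K] A p' q' := by
  subst h1; subst h2; exact LinearEquiv.refl K (A p q)

variable (d1 : ∀ p q : ℤ, A p q →ₗ[K] A (p + 1) q)
variable (d2 : ∀ p q : ℤ, A p q →ₗ[K] A p (q + 1))

/-- The operator ∂∂̄ : A^{p,q} → A^{p+1,q+1} (apply ∂̄ first, then ∂). -/
def ddBar (p q : ℤ) : A p q →ₗ[K] A (p + 1) (q + 1) := (d1 p (q + 1)).comp (d2 p q)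

/-- The image ∂∂̄(A^{p-1,q-1}) inside A^{p,q}. -/
def ddBarIm (p q : ℤ) : Submodule K (A p q) :=
  range ((dcCast K A (show p - 1 + 1 = p by ring) (show q - 1 + 1 = q by ring)).toLinearMap.comp
    (ddBar K A d1 d2 (p - 1) (q - 1)))

/-- Bott-Chern cohomology H_BC^{p,q} = (ker ∂ ∩ ker ∂̄)/∂∂̄(A^{p-1,q-1}). -/
abbrev HBC (p q : ℤ) :=
  ↥(ker (d1 p q) ⊓ ker (d2 p q)) ⧸
    ((ddBarIm K A d1 d2 p q).comap (ker (d1 p q) ⊓ ker (d2 p q)).subtype)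

noncomputable def hBC (p q : ℤ) : ℕ := finrank K (HBC K A d1 d2 p q)

/-- ∂(A^{p-1,q}) + ∂̄(A^{p,q-1}) inside A^{p,q}. -/
def aDen (p q : ℤ) : Submodule K (A p q) :=
  range ((dcCast K A (show p - 1 + 1 = p by ring) rfl).toLinearMap.comp (d1 (p - 1) q)) ⊔
  range ((dcCast K A rfl (show q - 1 + 1 = q by ring)).toLinearMap.comp (d2 p (q - 1)))

/-- Aeppli cohomology H_A^{p,q} = ker ∂∂̄ / (im ∂ + im ∂̄). -/
abbrev HA (p q : ℤ) :=
  ↥(ker (ddBar K A d1 d2 p q)) ⧸ ((aDen K A d1 d2 p q).comap (ker (ddBar K A d1 d2 p q)).subtype)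

noncomputable def hA (p q : ℤ) : ℕ := finrank K (HA K A d1 d2 p q)

/-- Column (Dolbeault) cohomology H_∂̄^{p,q}. -/
abbrev HDolb (p q : ℤ) :=
  ↥(ker (d2 p q)) ⧸
    ((range ((dcCast K A rfl (show q - 1 + 1 = q by ring)).toLinearMap.comp (d2 p (q - 1)))).comap
      (ker (d2 p q)).subtype)

noncomputable def hDolb (p q : ℤ) : ℕ := finrank K (HDolb K A d2 p q)

/-- Row cohomology H_∂^{p,q}. -/
abbrev HRow (p q : ℤ) :=
  ↥(ker (d1 p q)) ⧸
    ((range ((dcCast K A (show p - 1 + 1 = p by ring) rfl).toLinearMap.comp (d1 (p - 1) q))).comap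
      (ker (d1 p q)).subtype)

noncomputable def hRow (p q : ℤ) : ℕ := finrank K (HRow K A d1 p q)

/-- Total complex Tot^k = ⊕_{p+q=k} A^{p,q}. -/
abbrev Tot (k : ℤ) := ⨁ p : ℤ, A p (k - p)

/-- Total differential d = ∂ + ∂̄ on the total complex. -/
noncomputable def totD (k : ℤ) : Tot A k →ₗ[K] Tot A (k + 1) :=
  DirectSum.toModule K ℤ (Tot A (k + 1)) fun p =>
    ((DirectSum.lof K ℤ (fun p' => A p' (k + 1 - p')) (p + 1)).comp
      ((dcCast K A rfl (show k - p = k + 1 - (p + 1) by ring)).toLinearMap.comp (d1 p (k - p))))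
    +
    ((DirectSum.lof K ℤ (fun p' => A p' (k + 1 - p')) p).comp
      ((dcCast K A rfl (show k - p + 1 = k + 1 - p by ring)).toLinearMap.comp (d2 p (k - p))))

def totCast {k k' : ℤ} (h : k = k') : Tot A k ≃ₗ[K] Tot A k' := by
  subst h; exact LinearEquiv.refl K (Tot A k)

/-- b_k = dim H^k(Tot, d). -/
noncomputable def bNum (k : ℤ) : ℕ :=
  finrank K
    (↥(ker (totD K A d1 d2 k)) ⧸
      ((range ((totCast K A (show k - 1 + 1 = k by ring)).toLinearMap.comp
        (totD K A d1 d2 (k - 1)))).comap (ker (totD K A d1 d2 k)).subtype))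

/-- The ∂∂̄-lemma: ker ∂ ∩ ker ∂̄ ∩ (im ∂ + im ∂̄) ⊆ im ∂∂̄ in each bidegree. -/
def DDbarLemma : Prop :=
  ∀ p q : ℤ, (ker (d1 p q) ⊓ ker (d2 p q)) ⊓ aDen K A d1 d2 p q ≤ ddBarIm K A d1 d2 p q

end DoubleComplex

/-- The map between sub-quotients induced by the identity. -/
def qMap (K : Type) [Field K] {V : Type} [AddCommGroup V] [Module K V]
    {N1 N2 M1 M2 : Submodule K V} (hN : N1 ≤ N2) (hM : M1 ≤ M2) :
    (↥N1 ⧸ M1.comap N1.subtype) →ₗ[K] (↥N2 ⧸ M2.comap N2.subtype) :=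
  Submodule.mapQ _ _ (Submodule.inclusion hN) (by
    intro x hx
    simp only [Submodule.mem_comap, Submodule.coe_subtype] at hx ⊢
    simpa using hM hx)

section SComplex

variable (K : Type) [Field K]
variable (A : ℤ → Type) [∀ k, AddCommGroup (A k)] [∀ k, Module K (A k)]

def sCast {k k' : ℤ} (h : k = k') : A k ≃ₗ[K] A k' := by
  subst h; exact LinearEquiv.refl K (A k)

variable (d : ∀ k : ℤ, A k →ₗ[K] A (k + 1))
variable (dl : ∀ k : ℤ, A k →ₗ[K] A (k - 1))

/-- The degree-0 operator dδ : A^k → A^k (apply δ first, then d). -/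
def dDelta (k : ℤ) : A k →ₗ[K] A k :=
  (sCast K A (show k - 1 + 1 = k by ring)).toLinearMap.comp ((d (k - 1)).comp (dl k))

/-- Symplectic-type Bott-Chern cohomology H_BC^k = (ker d ∩ ker δ)/dδ(A^k). -/
abbrev HBCs (k : ℤ) :=
  ↥(ker (d k) ⊓ ker (dl k)) ⧸
    ((range (dDelta K A d dl k)).comap (ker (d k) ⊓ ker (dl k)).subtype)

noncomputable def hBCs (k : ℤ) : ℕ := finrank K (HBCs K A d dl k)

/-- d(A^{k-1}) + δ(A^{k+1}) inside A^k. -/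
def sDen (k : ℤ) : Submodule K (A k) :=
  range ((sCast K A (show k - 1 + 1 = k by ring)).toLinearMap.comp (d (k - 1))) ⊔
  range ((sCast K A (show k + 1 - 1 = k by ring)).toLinearMap.comp (dl (k + 1)))

/-- Symplectic-type Aeppli cohomology H_A^k = ker dδ / (im d + im δ). -/
abbrev HAs (k : ℤ) :=
  ↥(ker (dDelta K A d dl k)) ⧸ ((sDen K A d dl k).comap (ker (dDelta K A d dl k)).subtype)

noncomputable def hAs (k : ℤ) : ℕ := finrank K (HAs K A d dl k)

/-- H_d^k = ker d / im d. -/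
abbrev Hds (k : ℤ) :=
  ↥(ker (d k)) ⧸
    ((range ((sCast K A (show k - 1 + 1 = k by ring)).toLinearMap.comp (d (k - 1)))).comap
      (ker (d k)).subtype)

noncomputable def hds (k : ℤ) : ℕ := finrank K (Hds K A d k)

/-- H_δ^k = ker δ / im δ. -/
abbrev Hdls (k : ℤ) :=
  ↥(ker (dl k)) ⧸
    ((range ((sCast K A (show k + 1 - 1 = k by ring)).toLinearMap.comp (dl (k + 1)))).comap
      (ker (dl k)).subtype)

noncomputable def hdls (k : ℤ) : ℕ := finrank K (Hdls K A dl k)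

/-- The dδ-lemma: ker d ∩ ker δ ∩ (im d + im δ) ⊆ im dδ in each degree. -/
def DDeltaLemma : Prop :=
  ∀ k : ℤ, (ker (d k) ⊓ ker (dl k)) ⊓ sDen K A d dl k ≤ range (dDelta K A d dl k)

/-- The strip double complex B^{p,q} = A^{p-q}. -/
abbrev strip (p q : ℤ) := A (p - q)

/-- ∂ on the strip double complex, given by d. -/
def stripD1 (p q : ℤ) : strip A p q →ₗ[K] strip A (p + 1) q :=
  (sCast K A (show p - q + 1 = p + 1 - q by ring)).toLinearMap.comp (d (p - q))

/-- ∂̄ on the strip double complex, given by δ. -/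
def stripD2 (p q : ℤ) : strip A p q →ₗ[K] strip A p (q + 1) :=
  (sCast K A (show p - q - 1 = p - (q + 1) by ring)).toLinearMap.comp (dl (p - q))

end SComplex

section Graded

variable {K : Type} [Field K] {ι : Type} {M : ι → Type}
  [∀ p, AddCommGroup (M p)] [∀ p, Module K (M p)]

/-- The submodule of a direct sum whose elements have all components in a given family. -/
def gradedSub (N : ∀ p, Submodule K (M p)) : Submodule K (⨁ p, M p) :=
  ⨅ p, (N p).comap (DirectSum.component K ι M p)

theorem mem_gradedSub {N : ∀ p, Submodule K (M p)} {x : ⨁ p, M p} :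
    x ∈ gradedSub N ↔ ∀ p, x p ∈ N p := by
  simp only [gradedSub, Submodule.mem_iInf, Submodule.mem_comap]
  rfl

theorem gradedSub_top : gradedSub (fun p => (⊤ : Submodule K (M p))) = ⊤ :=
  eq_top_iff.2 fun _ _ => mem_gradedSub.2 fun _ => Submodule.mem_top

theorem eq_zero_of_forall_mem {S : Finset ι} (hS : ∀ p ∉ S, Subsingleton (M p))
    {x : ⨁ p, M p} (hx : ∀ p ∈ S, x p = 0) : x = 0 := by
  refine DFinsupp.ext fun p => ?_
  by_cases hp : p ∈ S
  · exact hx p hp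
  · have := hS p hp
    exact Subsingleton.elim _ _

theorem finiteDimensional_directSum [∀ p, FiniteDimensional K (M p)] {S : Finset ι}
    (hS : ∀ p ∉ S, Subsingleton (M p)) : FiniteDimensional K (⨁ p, M p) := by
  refine Module.Finite.of_injective
    (LinearMap.pi fun p : S => DirectSum.component K ι M p) ?_
  refine (injective_iff_map_eq_zero _).2 fun x hx => eq_zero_of_forall_mem hS fun p hp => ?_
  exact congrFun hx ⟨p, hp⟩

variable [DecidableEq ι]

theorem exists_directSum_apply_eq {S : Finset ι} (hS : ∀ p ∉ S, Subsingleton (M p))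
    (f : ∀ p, M p) : ∃ x : ⨁ p, M p, ∀ p, x p = f p := by
  refine ⟨DFinsupp.mk S fun p => f p, fun p => ?_⟩
  by_cases hp : p ∈ S
  · exact DFinsupp.mk_of_mem hp
  · have := hS p hp
    exact Subsingleton.elim _ _

theorem finrank_gradedSub [∀ p, FiniteDimensional K (M p)] {S : Finset ι}
    (hS : ∀ p ∉ S, Subsingleton (M p)) (N : ∀ p, Submodule K (M p)) :
    finrank K (gradedSub N) = ∑ p ∈ S, finrank K (N p) := by
  let f : gradedSub N →ₗ[K] (∀ p : S, N p) := LinearMap.pi fun p =>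
    LinearMap.codRestrict (N p) ((DirectSum.component K ι M p).comp (gradedSub N).subtype)
      fun x => mem_gradedSub.1 x.2 p
  have hf : Function.Bijective f := by
    constructor
    · refine (injective_iff_map_eq_zero _).2 fun x hx => Subtype.ext ?_
      refine eq_zero_of_forall_mem hS fun p hp => ?_
      exact congrArg Subtype.val (congrFun hx ⟨p, hp⟩)
    · intro g
      obtain ⟨x, hx⟩ := exists_directSum_apply_eq hS
        (fun p => if hp : p ∈ S then (g ⟨p, hp⟩ : M p) else 0)
      refine ⟨⟨x, mem_gradedSub.2 fun p => ?_⟩, ?_⟩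
      · rw [hx]
        split_ifs with hp
        · exact (g ⟨p, hp⟩).2
        · exact zero_mem _
      · funext p
        refine Subtype.ext ((hx p).trans ?_)
        simp
  rw [(LinearEquiv.ofBijective f hf).finrank_eq, Module.finrank_pi_fintype,
    Finset.sum_coe_sort S fun p => finrank K (N p)]

theorem finrank_directSum_eq_sum [∀ p, FiniteDimensional K (M p)] {S : Finset ι}
    (hS : ∀ p ∉ S, Subsingleton (M p)) :
    finrank K (⨁ p, M p) = ∑ p ∈ S, finrank K (M p) := by
  rw [← finrank_top, ← gradedSub_top, finrank_gradedSub hS]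
  simp

/-- A subspace each of whose nonzero elements has a nonzero component in `L` is no larger than
the sum of the `L p`. -/
theorem finrank_le_sum_of_exists_component_mem [∀ p, FiniteDimensional K (M p)] {S : Finset ι}
    (hS : ∀ p ∉ S, Subsingleton (M p)) (W : Submodule K (⨁ p, M p))
    (L : ∀ p, Submodule K (M p))
    (h : ∀ w ∈ W, w ≠ 0 → ∃ p, w p ≠ 0 ∧ w p ∈ L p) :
    finrank K W ≤ ∑ p ∈ S, finrank K (L p) := by
  choose π hπ using fun p =>
    LinearMap.exists_leftInverse_of_injective (L p).subtype (Submodule.ker_subtype _)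
  let f : W →ₗ[K] (∀ p : S, L p) := LinearMap.pi fun p =>
    (π p).comp ((DirectSum.component K ι M p).comp W.subtype)
  have hf : Function.Injective f := by
    refine (injective_iff_map_eq_zero _).2 fun w hw => ?_
    by_contra hne
    obtain ⟨p, hp, hpL⟩ := h w w.2 fun h0 => hne (Subtype.ext h0)
    have hpS : p ∈ S := by
      by_contra hpS
      have := hS p hpS
      exact hp (Subsingleton.elim _ _)
    have h1 : π p ((w : ⨁ p, M p) p) = 0 := congrFun hw ⟨p, hpS⟩
    have h2 : π p ((w : ⨁ p, M p) p) = ⟨_, hpL⟩ := LinearMap.congr_fun (hπ p) ⟨_, hpL⟩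
    exact hp (congrArg Subtype.val (h2.symm.trans h1))
  have := LinearMap.finrank_le_finrank_of_injective hf
  rwa [Module.finrank_pi_fintype, Finset.sum_coe_sort S fun p => finrank K (L p)] at this

theorem finrank_subquotient_add {V : Type} [AddCommGroup V] [Module K V] [FiniteDimensional K V]
    {N P : Submodule K V} (h : P ≤ N) :
    finrank K (↥N ⧸ P.comap N.subtype) + finrank K P = finrank K N := by
  rw [← (Submodule.comapSubtypeEquivOfLe h).finrank_eq]
  exact Submodule.finrank_quotient_add_finrank _

end Graded

section Shifted

variable (K : Type) [Field K]
variable (A : ℤ → ℤ → Type) [∀ p q, AddCommGroup (A p q)] [∀ p q, Module K (A p q)]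
variable (d1 : ∀ p q : ℤ, A p q →ₗ[K] A (p + 1) q)
variable (d2 : ∀ p q : ℤ, A p q →ₗ[K] A p (q + 1))

/-- `∂` with a freely chosen name for the target bidegree. -/
def del {p q p' q' : ℤ} (hp : p + 1 = p') (hq : q = q') : A p q →ₗ[K] A p' q' :=
  (dcCast K A hp hq).toLinearMap.comp (d1 p q)

/-- `∂̄` with a freely chosen name for the target bidegree. -/
def delBar {p q p' q' : ℤ} (hp : p = p') (hq : q + 1 = q') : A p q →ₗ[K] A p' q' :=
  (dcCast K A hp hq).toLinearMap.comp (d2 p q)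

/-- The differential of the total complex with a freely chosen name for the target degree. -/
noncomputable def totDel {k k' : ℤ} (h : k + 1 = k') : Tot A k →ₗ[K] Tot A k' :=
  (totCast K A h).toLinearMap.comp (totD K A d1 d2 k)

/-- The image of `∂` in bidegree `(p, q)`. -/
def delIm (p q : ℤ) : Submodule K (A p q) :=
  range (del K A d1 (show p - 1 + 1 = p by ring) (rfl : q = q))

/-- The image of `∂̄` in bidegree `(p, q)`. -/
def delBarIm (p q : ℤ) : Submodule K (A p q) :=
  range (delBar K A d2 (rfl : p = p) (show q - 1 + 1 = q by ring))

variable {K A d1 d2}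

theorem del_eq_zero_iff {p q p' q' : ℤ} (hp : p + 1 = p') (hq : q = q') (x : A p q) :
    del K A d1 hp hq x = 0 ↔ d1 p q x = 0 := by
  subst hp hq; rfl

theorem delBar_eq_zero_iff {p q p' q' : ℤ} (hp : p = p') (hq : q + 1 = q') (x : A p q) :
    delBar K A d2 hp hq x = 0 ↔ d2 p q x = 0 := by
  subst hp hq; rfl

theorem ddBar_eq_zero_iff {p q p' q' p'' q'' : ℤ} (h1 : p = p') (h2 : q + 1 = q')
    (h3 : p' + 1 = p'') (h4 : q' = q'') (x : A p q) :
    ddBar K A d1 d2 p q x = 0 ↔ del K A d1 h3 h4 (delBar K A d2 h1 h2 x) = 0 := by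
  subst h1 h2 h3 h4; rfl

theorem del_del (hd1d1 : ∀ (p q : ℤ) (x : A p q), d1 (p + 1) q (d1 p q x) = 0)
    {p q p' q' p'' q'' : ℤ} (h1 : p + 1 = p') (h2 : q = q') (h3 : p' + 1 = p'') (h4 : q' = q'')
    (x : A p q) : del K A d1 h3 h4 (del K A d1 h1 h2 x) = 0 := by
  subst h1 h2 h3 h4; exact hd1d1 _ _ _

theorem delBar_delBar (hd2d2 : ∀ (p q : ℤ) (x : A p q), d2 p (q + 1) (d2 p q x) = 0)
    {p q p' q' p'' q'' : ℤ} (h1 : p = p') (h2 : q + 1 = q') (h3 : p' = p'') (h4 : q' + 1 = q'')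
    (x : A p q) : delBar K A d2 h3 h4 (delBar K A d2 h1 h2 x) = 0 := by
  subst h1 h2 h3 h4; exact hd2d2 _ _ _

theorem delBar_del
    (hanti : ∀ (p q : ℤ) (x : A p q), d1 p (q + 1) (d2 p q x) + d2 (p + 1) q (d1 p q x) = 0)
    {p q p₁ q₁ p₂ q₂ p' q' : ℤ} (h1 : p + 1 = p₁) (h2 : q = q₁) (h3 : p₁ = p') (h4 : q₁ + 1 = q')
    (h5 : p = p₂) (h6 : q + 1 = q₂) (h7 : p₂ + 1 = p') (h8 : q₂ = q') (x : A p q) :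
    delBar K A d2 h3 h4 (del K A d1 h1 h2 x) = -del K A d1 h7 h8 (delBar K A d2 h5 h6 x) := by
  subst h1 h2 h3 h4 h5 h6
  exact eq_neg_of_add_eq_zero_right (hanti _ _ _)

theorem del_mem_delIm {p q p' q' : ℤ} (hp : p + 1 = p') (hq : q = q') (x : A p q) :
    del K A d1 hp hq x ∈ delIm K A d1 p' q' := by
  obtain rfl : p = p' - 1 := by omega
  subst hq
  exact ⟨x, rfl⟩

theorem delBar_mem_delBarIm {p q p' q' : ℤ} (hp : p = p') (hq : q + 1 = q') (x : A p q) :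
    delBar K A d2 hp hq x ∈ delBarIm K A d2 p' q' := by
  obtain rfl : q = q' - 1 := by omega
  subst hp
  exact ⟨x, rfl⟩

theorem aDen_eq (p q : ℤ) : aDen K A d1 d2 p q = delIm K A d1 p q ⊔ delBarIm K A d2 p q := rfl

theorem dcCast_ddBar {p q p' q' p₁ q₁ : ℤ} (hp : p + 1 = p') (hq : q + 1 = q') (h1 : p = p₁)
    (h2 : q + 1 = q₁) (h3 : p₁ + 1 = p') (h4 : q₁ = q') (x : A p q) :
    dcCast K A hp hq (ddBar K A d1 d2 p q x) = del K A d1 h3 h4 (delBar K A d2 h1 h2 x) := by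
  subst hp hq h1 h2; rfl

theorem mem_ddBarIm_iff {p q p₀ q₀ p₁ q₁ : ℤ} (h1 : p₀ = p₁) (h2 : q₀ + 1 = q₁)
    (h3 : p₁ + 1 = p) (h4 : q₁ = q) {y : A p q} :
    y ∈ ddBarIm K A d1 d2 p q ↔
      ∃ x : A p₀ q₀, del K A d1 h3 h4 (delBar K A d2 h1 h2 x) = y := by
  obtain rfl : p₀ = p - 1 := by omega
  obtain rfl : q₀ = q - 1 := by omega
  refine exists_congr fun x => ?_
  rw [← dcCast_ddBar (by ring) (by ring) h1 h2 h3 h4]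
  rfl

theorem totD_apply (k : ℤ) (x : Tot A k) {r p : ℤ} (hr : r + 1 = p) (h1 : k - r = k + 1 - p)
    (h2 : k - p + 1 = k + 1 - p) :
    totD K A d1 d2 k x p = del K A d1 hr h1 (x r) + delBar K A d2 rfl h2 (x p) := by
  subst hr
  induction x using DirectSum.induction_on with
  | zero => simp
  | add x y hx hy =>
    simp only [map_add, DirectSum.add_apply, hx, hy]
    abel
  | of i a =>
    change totD K A d1 d2 k (DirectSum.lof K ℤ (fun p => A p (k - p)) i a) (r + 1) = _
    rw [totD, DirectSum.toModule_lof, LinearMap.add_apply, DirectSum.add_apply]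
    congr 1
    · change DirectSum.of (fun p' => A p' (k + 1 - p')) (i + 1) _ (r + 1) = _
      by_cases h : r = i
      · subst h
        rw [DirectSum.of_eq_same, DirectSum.of_eq_same]
        rfl
      · rw [DirectSum.of_eq_of_ne _ _ _ (by omega), DirectSum.of_eq_of_ne _ _ _ h, map_zero]
    · change DirectSum.of (fun p' => A p' (k + 1 - p')) i _ (r + 1) = _
      by_cases h : r + 1 = i
      · subst h
        rw [DirectSum.of_eq_same, DirectSum.of_eq_same]
        rfl
      · rw [DirectSum.of_eq_of_ne _ _ _ h, DirectSum.of_eq_of_ne _ _ _ h, map_zero]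

theorem totDel_apply {k k' : ℤ} (h : k + 1 = k') (x : Tot A k) {r p : ℤ} (hr : r + 1 = p)
    (h1 : k - r = k' - p) (h2 : k - p + 1 = k' - p) :
    totDel K A d1 d2 h x p = del K A d1 hr h1 (x r) + delBar K A d2 rfl h2 (x p) := by
  subst h
  exact totD_apply k x hr h1 h2

theorem totDel_totDel (hd1d1 : ∀ (p q : ℤ) (x : A p q), d1 (p + 1) q (d1 p q x) = 0)
    (hd2d2 : ∀ (p q : ℤ) (x : A p q), d2 p (q + 1) (d2 p q x) = 0)
    (hanti : ∀ (p q : ℤ) (x : A p q), d1 p (q + 1) (d2 p q x) + d2 (p + 1) q (d1 p q x) = 0)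
    {k k' k'' : ℤ} (h : k + 1 = k') (h' : k' + 1 = k'') (x : Tot A k) :
    totDel K A d1 d2 h' (totDel K A d1 d2 h x) = 0 := by
  refine DFinsupp.ext fun p => ?_
  rw [totDel_apply h' _ (show p - 1 + 1 = p by ring) (by omega) (by omega),
    totDel_apply h _ (show p - 1 + 1 = p by ring) (by omega) (by omega),
    totDel_apply h _ (show p - 2 + 1 = p - 1 by ring) (by omega) (by omega),
    map_add, map_add, del_del hd1d1, delBar_delBar hd2d2,
    delBar_del hanti _ _ _ _ rfl (show k - (p - 1) + 1 = k' - (p - 1) by omega) (by omega)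
      (by omega)]
  simp

end Shifted

section Main

variable {K : Type} [Field K]
variable {A : ℤ → ℤ → Type} [∀ p q, AddCommGroup (A p q)] [∀ p q, Module K (A p q)]
variable {d1 : ∀ p q : ℤ, A p q →ₗ[K] A (p + 1) q}
variable {d2 : ∀ p q : ℤ, A p q →ₗ[K] A p (q + 1)}

variable (K A d1 d2) in
/-- The identities making `(A, d1, d2)` a double complex. -/
structure IsDoubleComplex : Prop where
  del_del : ∀ (p q : ℤ) (x : A p q), d1 (p + 1) q (d1 p q x) = 0
  delBar_delBar : ∀ (p q : ℤ) (x : A p q), d2 p (q + 1) (d2 p q x) = 0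
  anti : ∀ (p q : ℤ) (x : A p q), d1 p (q + 1) (d2 p q x) + d2 (p + 1) q (d1 p q x) = 0

variable (K A d1 d2) in
/-- The `∂`-closed elements whose `∂̄`-image is `∂`-exact. -/
def delDegenerate (p q : ℤ) : Submodule K (A p q) :=
  ker (d1 p q) ⊓ (delIm K A d1 p (q + 1)).comap (d2 p q)

variable (K A d1 d2) in
/-- The `∂̄`-closed elements whose `∂`-image is `∂̄`-exact. -/
def delBarDegenerate (p q : ℤ) : Submodule K (A p q) :=
  ker (d2 p q) ⊓ (delBarIm K A d2 (p + 1) q).comap (d1 p q)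

theorem mem_delDegenerate_iff {p q q' : ℤ} (hq : q + 1 = q') {x : A p q} :
    x ∈ delDegenerate K A d1 d2 p q ↔
      d1 p q x = 0 ∧ delBar K A d2 rfl hq x ∈ delIm K A d1 p q' := by
  subst hq; rfl

theorem mem_delBarDegenerate_iff {p q p' q' : ℤ} (hp : p + 1 = p') (hq : q = q') {x : A p q} :
    x ∈ delBarDegenerate K A d1 d2 p q ↔
      d2 p q x = 0 ∧ del K A d1 hp hq x ∈ delBarIm K A d2 p' q' := by
  subst hp hq; rfl

namespace IsDoubleComplex

theorem ddBar_eq_zero_iff' (H : IsDoubleComplex K A d1 d2) {p q : ℤ} (x : A p q) :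
    ddBar K A d1 d2 p q x = 0 ↔ d2 (p + 1) q (d1 p q x) = 0 := by
  change d1 p (q + 1) (d2 p q x) = 0 ↔ _
  rw [eq_neg_of_add_eq_zero_left (H.anti p q x), neg_eq_zero]

theorem delIm_le_ker (H : IsDoubleComplex K A d1 d2)
    (p q : ℤ) : delIm K A d1 p q ≤ ker (d1 p q) := by
  rintro _ ⟨x, rfl⟩
  rw [LinearMap.mem_ker, ← del_eq_zero_iff rfl rfl]
  exact Paper.del_del H.del_del _ _ _ _ _

theorem delBarIm_le_ker (H : IsDoubleComplex K A d1 d2)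
    (p q : ℤ) : delBarIm K A d2 p q ≤ ker (d2 p q) := by
  rintro _ ⟨x, rfl⟩
  rw [LinearMap.mem_ker, ← delBar_eq_zero_iff rfl rfl]
  exact Paper.delBar_delBar H.delBar_delBar _ _ _ _ _

theorem ddBarIm_le_im (H : IsDoubleComplex K A d1 d2) (p q : ℤ) :
    ddBarIm K A d1 d2 p q ≤ delIm K A d1 p q ⊓ delBarIm K A d2 p q := by
  intro y hy
  obtain ⟨x, rfl⟩ := (mem_ddBarIm_iff (rfl : p - 1 = p - 1) (show q - 1 + 1 = q by ring)
    (show p - 1 + 1 = p by ring) (rfl : q = q)).1 hy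
  refine ⟨del_mem_delIm _ _ _, ?_⟩
  rw [SetLike.mem_coe, ← neg_mem_iff,
    ← delBar_del H.anti (show p - 1 + 1 = p by ring) (rfl : q - 1 = q - 1) rfl
    (by ring)]
  exact delBar_mem_delBarIm _ _ _

theorem ddBarIm_le_ker (H : IsDoubleComplex K A d1 d2) (p q : ℤ) :
    ddBarIm K A d1 d2 p q ≤ ker (d1 p q) ⊓ ker (d2 p q) :=
  (H.ddBarIm_le_im p q).trans (inf_le_inf (H.delIm_le_ker p q) (H.delBarIm_le_ker p q))

theorem sup_ker_le (H : IsDoubleComplex K A d1 d2)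
    (p q : ℤ) : ker (d1 p q) ⊔ ker (d2 p q) ≤ ker (ddBar K A d1 d2 p q) := by
  refine sup_le (fun x hx => ?_) fun x hx => ?_
  · rw [LinearMap.mem_ker, H.ddBar_eq_zero_iff', LinearMap.mem_ker.1 hx, map_zero]
  · change d1 p (q + 1) (d2 p q x) = 0
    rw [LinearMap.mem_ker.1 hx, map_zero]

theorem aDen_le_ker (H : IsDoubleComplex K A d1 d2)
    (p q : ℤ) : aDen K A d1 d2 p q ≤ ker (ddBar K A d1 d2 p q) :=
  (sup_le_sup (H.delIm_le_ker p q) (H.delBarIm_le_ker p q)).trans (H.sup_ker_le p q)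

theorem ddbarLemma_of_degenerate (H : IsDoubleComplex K A d1 d2)
    (hker : ∀ p q, ker (ddBar K A d1 d2 p q) ≤ ker (d1 p q) ⊔ ker (d2 p q))
    (him : ∀ p q, delIm K A d1 p q ⊓ delBarIm K A d2 p q ≤ ddBarIm K A d1 d2 p q)
    (h1 : ∀ p q, ker (d1 p q) ≤ delDegenerate K A d1 d2 p q)
    (h2 : ∀ p q, ker (d2 p q) ≤ delBarDegenerate K A d1 d2 p q) :
    DDbarLemma K A d1 d2 := by
  rintro p q _ ⟨⟨hx1, hx2⟩, hx⟩
  rw [aDen_eq] at hx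
  obtain ⟨_, ⟨u, rfl⟩, _, ⟨v, rfl⟩, rfl⟩ := Submodule.mem_sup.1 hx
  refine add_mem (him p q ⟨del_mem_delIm _ _ _, ?_⟩) (him p q ⟨?_, delBar_mem_delBarIm _ _ _⟩)
  · have hu : u ∈ ker (ddBar K A d1 d2 (p - 1) q) := by
      rw [SetLike.mem_coe, LinearMap.mem_ker, map_add,
        LinearMap.mem_ker.1 (H.delBarIm_le_ker _ _ ⟨v, rfl⟩), add_zero,
        ← delBar_eq_zero_iff rfl rfl, delBar_del H.anti _ _ _ _ rfl rfl (by ring) rfl,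
        neg_eq_zero] at hx2
      rwa [LinearMap.mem_ker, ddBar_eq_zero_iff]
    obtain ⟨a, ha, b, hb, rfl⟩ := Submodule.mem_sup.1 (hker _ _ hu)
    rw [map_add, (del_eq_zero_iff _ _ a).2 ha, zero_add]
    exact ((mem_delBarDegenerate_iff _ _).1 (h2 _ _ hb)).2
  · have hv : v ∈ ker (ddBar K A d1 d2 p (q - 1)) := by
      rw [SetLike.mem_coe, LinearMap.mem_ker, map_add,
        LinearMap.mem_ker.1 (H.delIm_le_ker _ _ ⟨u, rfl⟩), zero_add,
        ← del_eq_zero_iff rfl rfl] at hx1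
      rwa [LinearMap.mem_ker, ddBar_eq_zero_iff]
    obtain ⟨a, ha, b, hb, rfl⟩ := Submodule.mem_sup.1 (hker _ _ hv)
    rw [map_add, (delBar_eq_zero_iff _ _ b).2 hb, add_zero]
    exact ((mem_delDegenerate_iff _).1 (h1 _ _ ha)).2

theorem range_totDel_le_ker (H : IsDoubleComplex K A d1 d2) {k k' : ℤ} (h : k + 1 = k') :
    range (totDel K A d1 d2 h) ≤ ker (totD K A d1 d2 k') := by
  rintro _ ⟨x, rfl⟩
  exact totDel_totDel H.del_del H.delBar_delBar H.anti h rfl x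

/-- Under the `∂∂̄`-lemma, an element that is closed under `∂` and `∂̄` and `∂`-exact is
`∂∂̄`-exact. -/
theorem exists_ddBar_eq_del (H : IsDoubleComplex K A d1 d2)
    (L : DDbarLemma K A d1 d2) {p q : ℤ} (x : A p q)
    (hx : ddBar K A d1 d2 p q x = 0) {p' q' q₀ : ℤ} (hp : p + 1 = p') (hq : q = q')
    (h0 : q₀ + 1 = q) :
    ∃ y : A p q₀, del K A d1 hp hq (delBar K A d2 rfl h0 y) = del K A d1 hp hq x := by
  subst hp hq
  refine (mem_ddBarIm_iff _ _ _ _).1 (L _ _ ⟨⟨?_, ?_⟩, ?_⟩)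
  · exact H.del_del _ _ x
  · exact (H.ddBar_eq_zero_iff' x).1 hx
  · exact Submodule.mem_sup_left (del_mem_delIm _ _ x)

theorem exists_ddBar_eq_delBar (H : IsDoubleComplex K A d1 d2)
    (L : DDbarLemma K A d1 d2) {p q : ℤ} (x : A p q)
    (hx : ddBar K A d1 d2 p q x = 0) {p₀ : ℤ} (h0 : p₀ + 1 = p) :
    ∃ y : A p₀ q, delBar K A d2 rfl rfl (del K A d1 h0 rfl y) = delBar K A d2 rfl rfl x := by
  have h : delBar K A d2 rfl rfl x ∈ ddBarIm K A d1 d2 p (q + 1) := by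
    refine L _ _ ⟨⟨?_, ?_⟩, ?_⟩
    · exact hx
    · exact H.delBar_delBar _ _ x
    · exact Submodule.mem_sup_right (delBar_mem_delBarIm _ _ x)
  obtain ⟨y, hy⟩ := (mem_ddBarIm_iff rfl rfl h0 rfl).1 h
  refine ⟨-y, ?_⟩
  rw [delBar_del H.anti _ _ _ _ rfl rfl h0 rfl, map_neg, map_neg, neg_neg, hy]

end IsDoubleComplex

/-- The equation `dx = 0` in components. -/
theorem totD_eq_zero_apply {k : ℤ} {x : Tot A k} (hx : totD K A d1 d2 k x = 0) {r p : ℤ}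
    (hr : r + 1 = p) (h1 : k - r = k + 1 - p) (h2 : k - p + 1 = k + 1 - p) :
    del K A d1 hr h1 (x r) + delBar K A d2 rfl h2 (x p) = 0 := by
  rw [← totD_apply k x hr h1 h2, hx]
  rfl

theorem exists_max_component {M : ℤ → Type} [∀ p, AddCommGroup (M p)] {w : ⨁ p, M p}
    (hw : w ≠ 0) : ∃ p, w p ≠ 0 ∧ ∀ r, p < r → w r = 0 := by
  classical
  have hne : (DFinsupp.support w).Nonempty :=
    Finset.nonempty_iff_ne_empty.2 fun h => hw (DFinsupp.support_eq_empty.1 h)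
  refine ⟨_, DFinsupp.mem_support_iff.1 (Finset.max'_mem _ hne), fun r hr => ?_⟩
  by_contra h
  exact absurd (Finset.le_max' _ _ (DFinsupp.mem_support_iff.2 h)) (not_le.2 hr)

theorem exists_min_component {M : ℤ → Type} [∀ p, AddCommGroup (M p)] {w : ⨁ p, M p}
    (hw : w ≠ 0) : ∃ p, w p ≠ 0 ∧ ∀ r, r < p → w r = 0 := by
  classical
  have hne : (DFinsupp.support w).Nonempty :=
    Finset.nonempty_iff_ne_empty.2 fun h => hw (DFinsupp.support_eq_empty.1 h)
  refine ⟨_, DFinsupp.mem_support_iff.1 (Finset.min'_mem _ hne), fun r hr => ?_⟩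
  by_contra h
  exact absurd (Finset.min'_le _ _ (DFinsupp.mem_support_iff.2 h)) (not_le.2 hr)

theorem ker_totDel {k k' : ℤ} (h : k + 1 = k') :
    ker (totDel K A d1 d2 h) = ker (totD K A d1 d2 k) := by
  subst h; rfl

theorem finrank_delIm_add [∀ p q, FiniteDimensional K (A p q)] {p q p' q' : ℤ}
    (hp : p + 1 = p') (hq : q = q') :
    finrank K (delIm K A d1 p' q') + finrank K (ker (d1 p q)) = finrank K (A p q) := by
  obtain rfl : p = p' - 1 := by omega
  subst hq
  have hk : ker (d1 (p' - 1) q) = ker (del K A d1 hp (rfl : q = q)) :=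
    Submodule.ext fun x => (del_eq_zero_iff hp rfl x).symm
  rw [hk]
  exact LinearMap.finrank_range_add_finrank_ker _

theorem finrank_delBarIm_add [∀ p q, FiniteDimensional K (A p q)] {p q q' : ℤ}
    (hq : q + 1 = q') :
    finrank K (delBarIm K A d2 p q') + finrank K (ker (d2 p q)) = finrank K (A p q) := by
  obtain rfl : q = q' - 1 := by omega
  have hk : ker (d2 p (q' - 1)) = ker (delBar K A d2 (rfl : p = p) hq) :=
    Submodule.ext fun x => (delBar_eq_zero_iff rfl hq x).symm
  rw [hk]
  exact LinearMap.finrank_range_add_finrank_ker _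

section Bounded

variable [∀ p q, FiniteDimensional K (A p q)] {S : Finset ℤ}

theorem finrank_ker_totD_le_del (hS : ∀ p ∉ S, ∀ q, Subsingleton (A p q)) (k : ℤ) :
    finrank K (ker (totD K A d1 d2 k)) ≤
      ∑ p ∈ S, finrank K (delDegenerate K A d1 d2 p (k - p)) := by
  refine finrank_le_sum_of_exists_component_mem (M := fun p => A p (k - p))
    (fun p hp => hS p hp _) _ _ fun w hw hne => ?_
  obtain ⟨p, hp, hmax⟩ := exists_max_component hne
  refine ⟨p, hp, (mem_delDegenerate_iff (show k - p + 1 = k + 1 - p by ring)).2 ⟨?_, ?_⟩⟩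
  · have h := totD_eq_zero_apply hw (rfl : p + 1 = p + 1) (by ring) (by ring)
    rwa [hmax (p + 1) (by omega), map_zero, add_zero, del_eq_zero_iff] at h
  · have h := totD_eq_zero_apply hw (show p - 1 + 1 = p by ring) (by ring) (by ring)
    rw [eq_neg_of_add_eq_zero_right h, neg_mem_iff]
    exact del_mem_delIm _ _ _

theorem finrank_ker_totD_le_delBar (hS : ∀ p ∉ S, ∀ q, Subsingleton (A p q)) (k : ℤ) :
    finrank K (ker (totD K A d1 d2 k)) ≤
      ∑ p ∈ S, finrank K (delBarDegenerate K A d1 d2 p (k - p)) := by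
  refine finrank_le_sum_of_exists_component_mem (M := fun p => A p (k - p))
    (fun p hp => hS p hp _) _ _ fun w hw hne => ?_
  obtain ⟨p, hp, hmin⟩ := exists_min_component hne
  refine ⟨p, hp, (mem_delBarDegenerate_iff (rfl : p + 1 = p + 1)
    (show k - p = k + 1 - (p + 1) by ring)).2 ⟨?_, ?_⟩⟩
  · have h := totD_eq_zero_apply hw (show p - 1 + 1 = p by ring) (by ring) (by ring)
    rwa [hmin (p - 1) (by omega), map_zero, zero_add, delBar_eq_zero_iff] at h
  · have h := totD_eq_zero_apply hw (rfl : p + 1 = p + 1) (by ring) (by ring)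
    rw [eq_neg_of_add_eq_zero_left h, neg_mem_iff]
    exact delBar_mem_delBarIm _ _ _

theorem sum_finrank_delBarIm_add (k : ℤ) :
    ∑ p ∈ S, finrank K (delBarIm K A d2 p (k - p)) +
      ∑ p ∈ S, finrank K (ker (d2 p (k - 1 - p))) = ∑ p ∈ S, finrank K (A p (k - 1 - p)) := by
  rw [← Finset.sum_add_distrib]
  exact Finset.sum_congr rfl fun p _ => finrank_delBarIm_add (by ring)

theorem sum_finrank_delIm_add (hS : ∀ p ∉ S, ∀ q, Subsingleton (A p q)) (k : ℤ) :
    ∑ p ∈ S, finrank K (delIm K A d1 p (k - p)) +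
      ∑ p ∈ S, finrank K (ker (d1 p (k - 1 - p))) = ∑ p ∈ S, finrank K (A p (k - 1 - p)) := by
  have hadd (p : ℤ) : finrank K (delIm K A d1 (p + 1) (k - (p + 1))) +
      finrank K (ker (d1 p (k - 1 - p))) = finrank K (A p (k - 1 - p)) :=
    finrank_delIm_add rfl (by ring)
  have hshift : ∑ p ∈ S, finrank K (delIm K A d1 p (k - p)) =
      ∑ p ∈ S, finrank K (delIm K A d1 (p + 1) (k - (p + 1))) := by
    rw [← finsum_eq_sum_of_support_subset, ← finsum_eq_sum_of_support_subset]
    · exact (finsum_comp_equiv (Equiv.addRight (1 : ℤ))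
        (f := fun p => finrank K (delIm K A d1 p (k - p)))).symm
    · refine Function.support_subset_iff'.2 fun p hp => ?_
      have := hS p hp (k - 1 - p)
      have h0 : finrank K (A p (k - 1 - p)) = 0 := finrank_zero_of_subsingleton
      have := hadd p
      omega
    · refine Function.support_subset_iff'.2 fun p hp => ?_
      have := hS p hp (k - p)
      exact finrank_zero_of_subsingleton
  rw [hshift, ← Finset.sum_add_distrib]
  exact Finset.sum_congr rfl fun p _ => hadd p

theorem finrank_range_totDel_add (hS : ∀ p ∉ S, ∀ q, Subsingleton (A p q)) {k k' : ℤ}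
    (h : k + 1 = k') :
    finrank K (range (totDel K A d1 d2 h)) + finrank K (ker (totD K A d1 d2 k)) =
      ∑ p ∈ S, finrank K (A p (k - p)) := by
  have hS' : ∀ p ∉ S, Subsingleton (A p (k - p)) := fun p hp => hS p hp _
  have := finiteDimensional_directSum (K := K) hS'
  rw [← ker_totDel h, LinearMap.finrank_range_add_finrank_ker]
  exact finrank_directSum_eq_sum hS'

namespace IsDoubleComplex

theorem hBC_add (H : IsDoubleComplex K A d1 d2) (p q : ℤ) :
    hBC K A d1 d2 p q + finrank K (ddBarIm K A d1 d2 p q) =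
      finrank K ↥(ker (d1 p q) ⊓ ker (d2 p q)) :=
  finrank_subquotient_add (H.ddBarIm_le_ker p q)

theorem hA_add (H : IsDoubleComplex K A d1 d2) (p q : ℤ) :
    hA K A d1 d2 p q + finrank K (aDen K A d1 d2 p q) =
      finrank K (ker (ddBar K A d1 d2 p q)) :=
  finrank_subquotient_add (H.aDen_le_ker p q)

theorem bNum_add (H : IsDoubleComplex K A d1 d2) (hS : ∀ p ∉ S, ∀ q, Subsingleton (A p q)) (k : ℤ) :
    bNum K A d1 d2 k + finrank K (range (totDel K A d1 d2 (show k - 1 + 1 = k by ring))) =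
      finrank K (ker (totD K A d1 d2 k)) := by
  have := finiteDimensional_directSum (K := K) (M := fun p => A p (k - p))
    fun p hp => hS p hp _
  exact finrank_subquotient_add (H.range_totDel_le_ker _)

/-- The dimension count behind the Varouchas exact sequences. -/
theorem hBC_add_hA (H : IsDoubleComplex K A d1 d2) (p q : ℤ) :
    hBC K A d1 d2 p q + hA K A d1 d2 p q +
      (finrank K (delIm K A d1 p q) + finrank K (delBarIm K A d2 p q) +
        finrank K ↥(ker (d1 p q) ⊔ ker (d2 p q)) + finrank K (ddBarIm K A d1 d2 p q)) =
      finrank K (ker (d1 p q)) + finrank K (ker (d2 p q)) +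
        finrank K (ker (ddBar K A d1 d2 p q)) +
        finrank K ↥(delIm K A d1 p q ⊓ delBarIm K A d2 p q) := by
  have h1 := H.hBC_add p q
  have h2 := H.hA_add p q
  have h3 := Submodule.finrank_sup_add_finrank_inf_eq (ker (d1 p q)) (ker (d2 p q))
  have h4 := Submodule.finrank_sup_add_finrank_inf_eq (delIm K A d1 p q) (delBarIm K A d2 p q)
  rw [aDen_eq] at h2
  omega

theorem degenerate_of_sum_eq (H : IsDoubleComplex K A d1 d2)
    (hS : ∀ p ∉ S, ∀ q, Subsingleton (A p q)) {k : ℤ}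
    (h : ∑ p ∈ S, (hBC K A d1 d2 p (k - p) + hA K A d1 d2 p (k - p)) = 2 * bNum K A d1 d2 k)
    (p : ℤ) :
    ker (ddBar K A d1 d2 p (k - p)) ≤ ker (d1 p (k - p)) ⊔ ker (d2 p (k - p)) ∧
    delIm K A d1 p (k - p) ⊓ delBarIm K A d2 p (k - p) ≤ ddBarIm K A d1 d2 p (k - p) ∧
    ker (d1 p (k - p)) ≤ delDegenerate K A d1 d2 p (k - p) ∧
    ker (d2 p (k - p)) ≤ delBarDegenerate K A d1 d2 p (k - p) := by
  have key {N P : ∀ p : ℤ, Submodule K (A p (k - p))} (hle : ∀ p, N p ≤ P p)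
      (hsum : ∑ p ∈ S, finrank K (N p) = ∑ p ∈ S, finrank K (P p)) : P p ≤ N p := by
    by_cases hp : p ∈ S
    · exact (Submodule.eq_of_le_of_finrank_eq (hle p) ((Finset.sum_eq_sum_iff_of_le
        fun i _ => Submodule.finrank_mono (hle i)).1 hsum p hp)).ge
    · have := hS p hp (k - p)
      exact le_of_eq (Subsingleton.elim _ _)
  have mono {j : ℤ} {N P : ∀ p : ℤ, Submodule K (A p (j - p))} (hle : ∀ p, N p ≤ P p) :
      ∑ p ∈ S, finrank K (N p) ≤ ∑ p ∈ S, finrank K (P p) :=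
    Finset.sum_le_sum fun i _ => Submodule.finrank_mono (hle i)
  have c1 (p q : ℤ) : delDegenerate K A d1 d2 p q ≤ ker (d1 p q) := inf_le_left
  have c2 (p q : ℤ) : delBarDegenerate K A d1 d2 p q ≤ ker (d2 p q) := inf_le_left
  have m1 := mono (j := k) fun p => c1 p _
  have m2 := mono (j := k) fun p => c2 p _
  have m3 := mono (j := k - 1) fun p => c1 p _
  have m4 := mono (j := k - 1) fun p => c2 p _
  have m5 := mono (j := k) fun p => H.sup_ker_le p _
  have m6 := mono (j := k) fun p => H.ddBarIm_le_im p _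
  have f1 := finrank_ker_totD_le_del (d1 := d1) (d2 := d2) hS k
  have f2 := finrank_ker_totD_le_delBar (d1 := d1) (d2 := d2) hS k
  have f3 := finrank_ker_totD_le_del (d1 := d1) (d2 := d2) hS (k - 1)
  have f4 := finrank_ker_totD_le_delBar (d1 := d1) (d2 := d2) hS (k - 1)
  have r1 := sum_finrank_delIm_add (d1 := d1) hS k
  have r2 := sum_finrank_delBarIm_add (d2 := d2) (S := S) k
  have r3 := finrank_range_totDel_add (d1 := d1) (d2 := d2) hS (show k - 1 + 1 = k by ring)
  have b := H.bNum_add hS k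
  have v := Finset.sum_congr (rfl : S = S) fun p _ => H.hBC_add_hA p (k - p)
  simp only [Finset.sum_add_distrib] at v h
  refine ⟨key (fun p => H.sup_ker_le p _) ?_, key (fun p => H.ddBarIm_le_im p _) ?_,
    key (fun p => c1 p _) ?_, key (fun p => c2 p _) ?_⟩ <;> omega

theorem hA_eq_hBC (H : IsDoubleComplex K A d1 d2) (L : DDbarLemma K A d1 d2) (p q : ℤ) :
    hA K A d1 d2 p q = hBC K A d1 d2 p q := by
  have h1 := H.hBC_add p q
  have h2 := H.hA_add p q
  have h3 := Submodule.finrank_sup_add_finrank_inf_eq (ker (d1 p q) ⊓ ker (d2 p q))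
    (aDen K A d1 d2 p q)
  have hinf : (ker (d1 p q) ⊓ ker (d2 p q)) ⊓ aDen K A d1 d2 p q = ddBarIm K A d1 d2 p q :=
    le_antisymm (L p q) (le_inf (H.ddBarIm_le_ker p q)
      ((H.ddBarIm_le_im p q).trans (inf_le_left.trans le_sup_left)))
  have hsup : (ker (d1 p q) ⊓ ker (d2 p q)) ⊔ aDen K A d1 d2 p q =
      ker (ddBar K A d1 d2 p q) := by
    refine le_antisymm (sup_le (inf_le_left.trans (le_sup_left.trans (H.sup_ker_le p q)))
      (H.aDen_le_ker p q)) fun x hx => ?_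
    obtain ⟨y, hy⟩ := H.exists_ddBar_eq_del L x hx rfl rfl (show q - 1 + 1 = q by ring)
    obtain ⟨z, hz⟩ := H.exists_ddBar_eq_delBar L x hx (show p - 1 + 1 = p by ring)
    set a := delBar K A d2 rfl (show q - 1 + 1 = q by ring) y
    set b := del K A d1 (show p - 1 + 1 = p by ring) rfl z
    rw [show x = (x - (a + b)) + (b + a) by abel]
    refine add_mem (Submodule.mem_sup_left ⟨?_, ?_⟩) (Submodule.mem_sup_right
      (Submodule.add_mem_sup (del_mem_delIm _ _ _) (delBar_mem_delBarIm _ _ _)))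
    · have hb : del K A d1 rfl rfl b = 0 := Paper.del_del H.del_del _ _ _ _ _
      rw [SetLike.mem_coe, LinearMap.mem_ker, ← del_eq_zero_iff rfl rfl, map_sub, map_add, hy, hb]
      simp
    · have ha : delBar K A d2 rfl rfl a = 0 := Paper.delBar_delBar H.delBar_delBar _ _ _ _ _
      rw [SetLike.mem_coe, LinearMap.mem_ker, ← delBar_eq_zero_iff rfl rfl, map_sub, map_add, hz,
        ha]
      simp
  rw [hinf, hsup] at h3
  omega

theorem bNum_eq_sum_hBC (H : IsDoubleComplex K A d1 d2)
    (L : DDbarLemma K A d1 d2) (hS : ∀ p ∉ S, ∀ q, Subsingleton (A p q))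
    (k : ℤ) : bNum K A d1 d2 k = ∑ p ∈ S, hBC K A d1 d2 p (k - p) := by
  have hk : k - 1 + 1 = k := by ring
  have hS' : ∀ p ∉ S, Subsingleton (A p (k - p)) := fun p hp => hS p hp _
  have := finiteDimensional_directSum (K := K) hS'
  have h3 := Submodule.finrank_sup_add_finrank_inf_eq
    (gradedSub fun p => ker (d1 p (k - p)) ⊓ ker (d2 p (k - p))) (range (totDel K A d1 d2 hk))
  have hinf : (gradedSub fun p => ker (d1 p (k - p)) ⊓ ker (d2 p (k - p))) ⊓
      range (totDel K A d1 d2 hk) = gradedSub fun p => ddBarIm K A d1 d2 p (k - p) := by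
    refine le_antisymm ?_ fun x hx => ?_
    · rintro _ ⟨hx, y, rfl⟩
      refine mem_gradedSub.2 fun p => L _ _ ⟨mem_gradedSub.1 hx p, ?_⟩
      rw [totDel_apply hk _ (show p - 1 + 1 = p by ring) (by ring) (by ring)]
      exact Submodule.add_mem_sup (del_mem_delIm _ _ _) (delBar_mem_delBarIm _ _ _)
    · refine ⟨mem_gradedSub.2 fun p => H.ddBarIm_le_ker _ _ (mem_gradedSub.1 hx p), ?_⟩
      choose z hz using fun r => (mem_ddBarIm_iff (rfl : r = r)
        (show k - 2 - r + 1 = k - 1 - r by ring) (rfl : r + 1 = r + 1)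
        (show k - 1 - r = k - (r + 1) by ring)).1 (mem_gradedSub.1 hx (r + 1))
      obtain ⟨y, hy⟩ := exists_directSum_apply_eq (M := fun p => A p (k - 1 - p))
        (fun p hp => hS p hp _) fun r => delBar K A d2 rfl
          (show k - 2 - r + 1 = k - 1 - r by ring) (z r)
      refine ⟨y, DFinsupp.ext fun p => ?_⟩
      obtain ⟨r, rfl⟩ : ∃ r, p = r + 1 := ⟨p - 1, by ring⟩
      rw [totDel_apply hk _ (rfl : r + 1 = r + 1) (by ring) (by ring), hy, hy,
        Paper.delBar_delBar H.delBar_delBar, add_zero, hz]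
  have hsup : (gradedSub fun p => ker (d1 p (k - p)) ⊓ ker (d2 p (k - p))) ⊔
      range (totDel K A d1 d2 hk) = ker (totD K A d1 d2 k) := by
    refine le_antisymm (sup_le (fun x hx => DFinsupp.ext fun p => ?_)
      (H.range_totDel_le_ker hk)) fun x hx => ?_
    · rw [totD_apply k x (show p - 1 + 1 = p by ring) (by ring) (by ring),
        (del_eq_zero_iff _ _ _).2 (mem_gradedSub.1 hx _).1,
        (delBar_eq_zero_iff _ _ _).2 (mem_gradedSub.1 hx _).2, add_zero]
      rfl
    · have hdx {r p : ℤ} (hr : r + 1 = p) (h1 : k - r = k + 1 - p) (h2 : k - p + 1 = k + 1 - p) :=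
        totD_eq_zero_apply (d1 := d1) (d2 := d2) hx hr h1 h2
      have hxp (p : ℤ) : ddBar K A d1 d2 p (k - p) (x p) = 0 := by
        rw [ddBar_eq_zero_iff rfl (show k - p + 1 = k + 1 - p by ring) (rfl : p + 1 = p + 1) rfl,
          eq_neg_of_add_eq_zero_right (hdx (show p - 1 + 1 = p by ring) (by ring) (by ring)),
          map_neg, Paper.del_del H.del_del, neg_zero]
      choose y hy using fun p => H.exists_ddBar_eq_del L (x p) (hxp p) (rfl : p + 1 = p + 1)
        (show k - p = k + 1 - (p + 1) by ring) (show k - 1 - p + 1 = k - p by ring)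
      obtain ⟨y', hy'⟩ := exists_directSum_apply_eq (M := fun p => A p (k - 1 - p))
        (fun p hp => hS p hp _) y
      rw [← sub_add_cancel x (totDel K A d1 d2 hk y')]
      refine Submodule.add_mem_sup (mem_gradedSub.2 fun p => ?_) ⟨y', rfl⟩
      obtain ⟨r, rfl⟩ : ∃ r, p = r + 1 := ⟨p - 1, by ring⟩
      rw [DirectSum.sub_apply, totDel_apply hk _ (rfl : r + 1 = r + 1) (by ring) (by ring), hy',
        hy']
      constructor
      · rw [SetLike.mem_coe, LinearMap.mem_ker, ← del_eq_zero_iff rfl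
          (show k - (r + 1) = k + 1 - (r + 1 + 1) by ring), map_sub, map_add, hy,
          Paper.del_del H.del_del]
        simp
      · rw [SetLike.mem_coe, LinearMap.mem_ker, ← delBar_eq_zero_iff rfl
          (show k - (r + 1) + 1 = k + 1 - (r + 1) by ring), map_sub, map_add,
          Paper.delBar_delBar H.delBar_delBar,
          delBar_del H.anti _ _ _ _ rfl (show k - 1 - r + 1 = k - r by ring) rfl (by ring), hy,
          ← eq_neg_of_add_eq_zero_right (hdx (rfl : r + 1 = r + 1) (by ring) (by ring))]
        simp
  rw [hinf, hsup, finrank_gradedSub hS', finrank_gradedSub hS'] at h3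
  replace h3 : finrank K (ker (totD K A d1 d2 k)) +
      ∑ p ∈ S, finrank K (ddBarIm K A d1 d2 p (k - p)) =
      ∑ p ∈ S, finrank K ↥(ker (d1 p (k - p)) ⊓ ker (d2 p (k - p))) +
        finrank K (range (totDel K A d1 d2 hk)) := h3
  have b := H.bNum_add hS k
  have c := Finset.sum_congr (rfl : S = S) fun p _ => H.hBC_add p (k - p)
  rw [Finset.sum_add_distrib] at c
  omega

end IsDoubleComplex

end Bounded

end Main

theorem ddbar_lemma_iff_delta_zero (K : Type) [Field K]
    (A : ℤ → ℤ → Type) [∀ p q, AddCommGroup (A p q)] [∀ p q, Module K (A p q)]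
    [∀ p q, FiniteDimensional K (A p q)]
    (d1 : ∀ p q : ℤ, A p q →ₗ[K] A (p + 1) q)
    (d2 : ∀ p q : ℤ, A p q →ₗ[K] A p (q + 1))
    (hbdd : {pq : ℤ × ℤ | Nontrivial (A pq.1 pq.2)}.Finite)
    (hd1d1 : ∀ (p q : ℤ) (x : A p q), d1 (p + 1) q (d1 p q x) = 0)
    (hd2d2 : ∀ (p q : ℤ) (x : A p q), d2 p (q + 1) (d2 p q x) = 0)
    (hanti : ∀ (p q : ℤ) (x : A p q), d1 p (q + 1) (d2 p q x) + d2 (p + 1) q (d1 p q x) = 0) :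
    DDbarLemma K A d1 d2 ↔
      ∀ k : ℤ,
        ∑ᶠ p : ℤ, (hBC K A d1 d2 p (k - p) + hA K A d1 d2 p (k - p)) = 2 * bNum K A d1 d2 k := by
  have H : IsDoubleComplex K A d1 d2 := ⟨hd1d1, hd2d2, hanti⟩
  let S : Finset ℤ := hbdd.toFinset.image Prod.fst
  have hS : ∀ p ∉ S, ∀ q, Subsingleton (A p q) := by
    intro p hp q
    by_contra h
    exact hp (Finset.mem_image.2
      ⟨(p, q), hbdd.mem_toFinset.2 (not_subsingleton_iff_nontrivial.1 h), rfl⟩)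
  have hsum (k : ℤ) : ∑ᶠ p : ℤ, (hBC K A d1 d2 p (k - p) + hA K A d1 d2 p (k - p)) =
      ∑ p ∈ S, (hBC K A d1 d2 p (k - p) + hA K A d1 d2 p (k - p)) := by
    refine finsum_eq_sum_of_support_subset _ (Function.support_subset_iff'.2 fun p hp => ?_)
    have := hS p hp (k - p)
    exact Nat.add_eq_zero_iff.2 ⟨finrank_zero_of_subsingleton, finrank_zero_of_subsingleton⟩
  constructor
  · intro L k
    rw [hsum, H.bNum_eq_sum_hBC L hS, two_mul, ← Finset.sum_add_distrib]
    exact Finset.sum_congr rfl fun p _ => by rw [H.hA_eq_hBC L]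
  · intro h
    have deg (p q : ℤ) :
        ker (ddBar K A d1 d2 p q) ≤ ker (d1 p q) ⊔ ker (d2 p q) ∧
        delIm K A d1 p q ⊓ delBarIm K A d2 p q ≤ ddBarIm K A d1 d2 p q ∧
        ker (d1 p q) ≤ delDegenerate K A d1 d2 p q ∧
        ker (d2 p q) ≤ delBarDegenerate K A d1 d2 p q := by
      obtain ⟨k, rfl⟩ : ∃ k, q = k - p := ⟨q + p, by ring⟩
      exact H.degenerate_of_sum_eq hS ((hsum k).symm.trans (h k)) p
    exact H.ddbarLemma_of_degenerate (fun p q => (deg p q).1) (fun p q => (deg p q).2.1)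
      (fun p q => (deg p q).2.2.1) (fun p q => (deg p q).2.2.2)

end Paper
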